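/- arXiv:0810.1419 — 2 statements merged into one kernel-verified Lean document; each statement's English description precedes it below -/
import Mathlib

section
/- Integrated weak form of the evolution inequality (relation (2.15) of the paper). Let T > 0, let z : ℝ → Z be differentiable at every τ ∈ [0,T] with derivative ż(τ), satisfying the dissipative Hamiltonian inclusion at every τ ∈ [0,T] for H : ℝ → Z → ℝ and R : Z → Z → ℝ. Let f : ℝ → Z → ℝ be such that: for each τ ∈ [0,T], f(τ,·) has a gradient ∇₂f(τ,w) at every w ∈ Z and a partial time derivative ∂ₜf(τ,w) exists; the map τ ↦ f(τ, z(τ)) has at every τ ∈ [0,T] the derivative ∂ₜf(τ,z(τ)) + ⟪∇₂f(τ,z(τ)), ż(τ)⟫, this derivative being interval-integrable on [0,T]; and the maps τ ↦ R(z(τ), ż(τ)), τ ↦ R(z(τ), ż(τ) − X_{f(τ,·)}(z(τ))), τ ↦ ∂ₜf(τ,z(τ)) and τ ↦ ω(X_{f(τ,·)}(z(τ)), X_{H(τ,·)}(z(τ))) are interval-integrable on [0,T]. Then for every t ∈ [0,T]: ∫₀ᵗ R(z(τ), ż(τ) − X_{f(τ,·)}(z(τ))) dτ ≥ ∫₀ᵗ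 R(z(τ), ż(τ)) dτ + f(t, z(t)) − f(0, z(0)) − ∫₀ᵗ [∂ₜf(τ, z(τ)) + ω(X_{f(τ,·)}(z(τ)), X_{H(τ,·)}(z(τ)))] dτ. -/
open MeasureTheory intervalIntegral Set
open scoped RealInnerProductSpace

noncomputable def innerZ {E : Type*} [NormedAddCommGroup E] [InnerProductSpace ℝ E]
    (a b : E × E) : ℝ :=
  ⟪a.1, b.1⟫ + ⟪a.2, b.2⟫

noncomputable def sympl {E : Type*} [NormedAddCommGroup E] [InnerProductSpace ℝ E]
    (a b : E × E) : ℝ :=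
  ⟪a.1, b.2⟫ - ⟪b.1, a.2⟫

/-- symplectic gradient associated to a gradient `g`. -/
def Xg {E : Type*} [NormedAddCommGroup E] (g : E × E) : E × E := (g.2, -g.1)

/-- `F : E × E → ℝ` has gradient `g` (w.r.t. the product inner product) at `z`:
the Fréchet derivative of `F` at `z` is `⟪g, ·⟫`. -/
noncomputable def HasGradZAt {E : Type*} [NormedAddCommGroup E] [InnerProductSpace ℝ E]
    (F : E × E → ℝ) (g z : E × E) : Prop :=
  HasFDerivAt F
    (((innerSL ℝ g.1).comp (ContinuousLinearMap.fst ℝ E E)) +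
      ((innerSL ℝ g.2).comp (ContinuousLinearMap.snd ℝ E E))) z

/-- dissipative Hamiltonian inclusion at a point: `R` dissipation, `zt` current state,
`zdot` rate, `gradH` gradient of the current Hamiltonian at the current state. -/
def DissInclAt {E : Type*} [NormedAddCommGroup E] [InnerProductSpace ℝ E]
    (R : (E × E) → (E × E) → ℝ) (zt zdot gradH : E × E) : Prop :=
  ∀ z'' : E × E, R zt (zdot + z'') ≥ R zt zdot + sympl (zdot - Xg gradH) z''

/-- dissipation distance associated to a dissipation function `R`. -/
noncomputable def dissDist {V : Type*} [NormedAddCommGroup V] [NormedSpace ℝ V]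
    (R : V → V → ℝ) (a b : V) : ENNReal :=
  sInf { c : ENNReal | ∃ γ γd : ℝ → V, γ 0 = a ∧ γ 1 = b ∧
    (∀ s ∈ Set.Icc (0:ℝ) 1, HasDerivAt γ (γd s) s) ∧
    IntervalIntegrable (fun s => R (γ s) (γd s)) volume 0 1 ∧
    c = ENNReal.ofReal (∫ s in (0:ℝ)..1, R (γ s) (γd s)) }

theorem sympl_sub_neg_Xg {E : Type*} [NormedAddCommGroup E] [InnerProductSpace ℝ E]
    (v g h : E × E) :
    sympl (v - Xg h) (-Xg g) = innerZ g v - sympl (Xg g) (Xg h) := by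
  simp only [sympl, innerZ, Xg, Prod.fst_sub, Prod.snd_sub, Prod.fst_neg, Prod.snd_neg,
    inner_sub_left, inner_sub_right, inner_neg_left, inner_neg_right]
  rw [real_inner_comm g.1 v.1, real_inner_comm g.1 h.2]
  ring

/-- Integrated weak form of the evolution inequality (relation (2.15)). -/
theorem integrated_weak_form
    {E : Type*} [NormedAddCommGroup E] [InnerProductSpace ℝ E]
    (T : ℝ) (hT : 0 < T)
    (z zdot : ℝ → E × E)
    (H : ℝ → E × E → ℝ) (gradH : ℝ → E × E → E × E)
    (R : (E × E) → (E × E) → ℝ)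
    (f : ℝ → E × E → ℝ) (gradf : ℝ → E × E → E × E) (ft : ℝ → E × E → ℝ)
    (hderiv : ∀ τ ∈ Icc (0:ℝ) T, HasDerivAt z (zdot τ) τ)
    (hgradH : ∀ τ ∈ Icc (0:ℝ) T, ∀ w, HasGradZAt (H τ) (gradH τ w) w)
    (hincl : ∀ τ ∈ Icc (0:ℝ) T, DissInclAt R (z τ) (zdot τ) (gradH τ (z τ)))
    (hgradf : ∀ τ ∈ Icc (0:ℝ) T, ∀ w, HasGradZAt (f τ) (gradf τ w) w)
    (hft : ∀ τ ∈ Icc (0:ℝ) T, ∀ w, HasDerivAt (fun s => f s w) (ft τ w) τ)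
    (hchain : ∀ τ ∈ Icc (0:ℝ) T,
      HasDerivAt (fun s => f s (z s))
        (ft τ (z τ) + innerZ (gradf τ (z τ)) (zdot τ)) τ)
    (hchainInt : IntervalIntegrable
      (fun τ => ft τ (z τ) + innerZ (gradf τ (z τ)) (zdot τ)) volume 0 T)
    (hRInt : IntervalIntegrable (fun τ => R (z τ) (zdot τ)) volume 0 T)
    (hRfInt : IntervalIntegrable
      (fun τ => R (z τ) (zdot τ - Xg (gradf τ (z τ)))) volume 0 T)
    (hftInt : IntervalIntegrable (fun τ => ft τ (z τ)) volume 0 T)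
    (hPoissonInt : IntervalIntegrable
      (fun τ => sympl (Xg (gradf τ (z τ))) (Xg (gradH τ (z τ)))) volume 0 T) :
    ∀ t ∈ Icc (0:ℝ) T,
      (∫ τ in (0:ℝ)..t, R (z τ) (zdot τ - Xg (gradf τ (z τ)))) ≥
        (∫ τ in (0:ℝ)..t, R (z τ) (zdot τ))
          + f t (z t) - f 0 (z 0)
          - ∫ τ in (0:ℝ)..t,
              (ft τ (z τ) + sympl (Xg (gradf τ (z τ))) (Xg (gradH τ (z τ)))) := by
  intro t ht
  have hsub : uIcc (0:ℝ) t ⊆ uIcc 0 T := by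
    rw [uIcc_of_le ht.1, uIcc_of_le hT.le]
    exact Icc_subset_Icc_right ht.2
  have hR := hRInt.mono_set hsub
  have hC := hchainInt.mono_set hsub
  have hP := (hftInt.mono_set hsub).add (hPoissonInt.mono_set hsub)
  have hFTC := integral_eq_sub_of_hasDerivAt
    (fun τ hτ => hchain τ (by rw [uIcc_of_le ht.1] at hτ; exact ⟨hτ.1, hτ.2.trans ht.2⟩)) hC
  have hmono := integral_mono_on ht.1 ((hR.add hC).sub hP) (hRfInt.mono_set hsub)
    (fun τ hτ => by
      have h := hincl τ ⟨hτ.1, hτ.2.trans ht.2⟩ (-Xg (gradf τ (z τ)))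
      rw [sympl_sub_neg_Xg, ← sub_eq_add_neg] at h
      linarith)
  have hsplit := integral_sub (hR.add hC) hP
  have hadd := integral_add hR hC
  linarith
end

section
/- The dissipation along a weak solution dominates the dissipation distance. Let R : Z → Z → ℝ satisfy R(w,v) ≥ 0, R(w,0) = 0, and positive 1-homogeneity R(w, λ•v) = λ·R(w,v) for all λ ≥ 0, v ∈ Z, w ∈ Z. Let T > 0 and let z : ℝ → Z be differentiable at every τ ∈ [0,T] with derivative ż(τ), satisfying the dissipative Hamiltonian inclusion at every τ ∈ [0,T] for a Hamiltonian H : ℝ → Z → ℝ, and assume τ ↦ R(z(τ), ż(τ)) and τ ↦ ω(ż(τ), X_{H(τ,·)}(z(τ))) are interval-integrable on [0,T]. Then for every t ∈ (0,T], the dissipation η(t) := ∫₀ᵗ ω(ż(τ), X_{H(τ,·)}(z(τ))) dτ satisfies η(t) ≥ D(z(0), z(t)) ≥ 0, where D is the dissipation distance associated to R (in the sense that the extended real D(z(0), z(t)) is at most the extended real coercion of η(t)). -/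
open MeasureTheory intervalIntegral Set
open scoped RealInnerProductSpace

/-- Testing the inclusion with `-zdot` bounds the dissipation rate by the symplectic power. -/
theorem DissInclAt.le_sympl {E : Type*} [NormedAddCommGroup E] [InnerProductSpace ℝ E]
    {R : (E × E) → (E × E) → ℝ} {w v g : E × E} (h : DissInclAt R w v g) (h0 : R w 0 = 0) :
    R w v ≤ sympl v (Xg g) := by
  have h1 := h (-v)
  rw [add_neg_cancel, h0] at h1
  have h2 : sympl (v - Xg g) (-v) = -sympl v (Xg g) := by
    simp only [sympl, Prod.fst_sub, Prod.snd_sub, Prod.fst_neg, Prod.snd_neg, inner_neg_left,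
      inner_neg_right, inner_sub_left, inner_sub_right]
    ring
  linarith

/-- A curve on `[0, t]` bounds the dissipation distance of its end points: reparametrize it
affinely to `[0, 1]`. -/
theorem dissDist_le_ofReal_integral {V : Type*} [NormedAddCommGroup V] [NormedSpace ℝ V]
    {R : V → V → ℝ} (hhom : ∀ w : V, ∀ l : ℝ, 0 ≤ l → ∀ v : V, R w (l • v) = l * R w v)
    {z zdot : ℝ → V} {t : ℝ} (ht : 0 < t)
    (hderiv : ∀ τ ∈ Icc (0 : ℝ) t, HasDerivAt z (zdot τ) τ)
    (hint : IntervalIntegrable (fun τ => R (z τ) (zdot τ)) volume 0 t) :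
    dissDist R (z 0) (z t) ≤ ENNReal.ofReal (∫ τ in (0 : ℝ)..t, R (z τ) (zdot τ)) := by
  have hscale : (fun s => R (z (t * s)) (t • zdot (t * s))) =
      fun s => t * R (z (t * s)) (zdot (t * s)) :=
    funext fun s => hhom _ t ht.le _
  refine sInf_le ⟨fun s => z (t * s), fun s => t • zdot (t * s), by simp, by simp, ?_, ?_, ?_⟩
  · intro s hs
    have hmem : t * s ∈ Icc (0 : ℝ) t :=
      ⟨mul_nonneg ht.le hs.1, mul_le_of_le_one_right ht.le hs.2⟩
    have hlin : HasDerivAt (fun s : ℝ => t * s) t s := by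
      simpa using (hasDerivAt_id s).const_mul t
    exact (hderiv _ hmem).scomp s hlin
  · rw [hscale]
    have h := (hint.comp_mul_left (c := t)).const_mul t
    simpa [ht.ne'] using h
  · rw [hscale, intervalIntegral.integral_const_mul,
      intervalIntegral.mul_integral_comp_mul_left (f := fun τ => R (z τ) (zdot τ))]
    simp

/-- The dissipation along a weak solution dominates the dissipation distance. -/
theorem dissipation_dominates_dissipation_distance
    {E : Type*} [NormedAddCommGroup E] [InnerProductSpace ℝ E]
    (T : ℝ) (hT : 0 < T)
    (z zdot : ℝ → E × E)
    (H : ℝ → E × E → ℝ) (gradH : ℝ → E × E → E × E)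
    (R : (E × E) → (E × E) → ℝ)
    (hRnonneg : ∀ w v : E × E, 0 ≤ R w v)
    (hRzero : ∀ w : E × E, R w 0 = 0)
    (hhom : ∀ w : E × E, ∀ l : ℝ, 0 ≤ l → ∀ v : E × E, R w (l • v) = l * R w v)
    (hderiv : ∀ τ ∈ Icc (0:ℝ) T, HasDerivAt z (zdot τ) τ)
    (hgradH : ∀ τ ∈ Icc (0:ℝ) T, ∀ w, HasGradZAt (H τ) (gradH τ w) w)
    (hincl : ∀ τ ∈ Icc (0:ℝ) T, DissInclAt R (z τ) (zdot τ) (gradH τ (z τ)))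
    (hRInt : IntervalIntegrable (fun τ => R (z τ) (zdot τ)) volume 0 T)
    (hωInt : IntervalIntegrable
      (fun τ => sympl (zdot τ) (Xg (gradH τ (z τ)))) volume 0 T) :
    ∀ t ∈ Ioc (0:ℝ) T,
      ENNReal.ofReal (∫ τ in (0:ℝ)..t, sympl (zdot τ) (Xg (gradH τ (z τ)))) ≥
        dissDist R (z 0) (z t) ∧
      dissDist R (z 0) (z t) ≥ 0 := by
  intro t ht
  have hsub : uIcc 0 t ⊆ uIcc 0 T := by
    rw [uIcc_of_le ht.1.le, uIcc_of_le hT.le]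
    exact Icc_subset_Icc_right ht.2
  have hmem : ∀ τ ∈ Icc (0 : ℝ) t, τ ∈ Icc (0 : ℝ) T := fun τ hτ => ⟨hτ.1, hτ.2.trans ht.2⟩
  have hR := hRInt.mono_set hsub
  refine ⟨?_, zero_le⟩
  refine (dissDist_le_ofReal_integral hhom ht.1 (fun τ hτ => hderiv τ (hmem τ hτ)) hR).trans ?_
  exact ENNReal.ofReal_le_ofReal <| intervalIntegral.integral_mono_on ht.1.le hR
    (hωInt.mono_set hsub) fun τ hτ => (hincl τ (hmem τ hτ)).le_sympl (hRzero _)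
end
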